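/- Let 𝒥 be a proper constrained level graph of height 3 without isolated vertices and let Γ be a constrained level planar drawing of 𝒥. If C, C′, and C″ are three pairwise distinct connected components of 𝒥, then Span_Γ(C) ∩ Span_Γ(C′) ∩ Span_Γ(C″) = ∅. -/

import Mathlib

open scoped Classical

/-- A constrained level graph: a finite directed graph with a surjective level
assignment `lvl : V → {1, …, h}` such that edges go strictly upwards, together
with a partial order `≺ᵢ` on each level. -/
structure ConstrainedLevelGraph (V : Type) [Fintype V] where
  h : ℕ
  Edge : V → V → Prop
  lvl : V → ℕ
  lvl_one_le : ∀ v, 1 ≤ lvl v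
  lvl_le : ∀ v, lvl v ≤ h
  lvl_surj : ∀ i, 1 ≤ i → i ≤ h → ∃ v, lvl v = i
  edge_lt : ∀ u v, Edge u v → lvl u < lvl v
  prec : ℕ → V → V → Prop
  prec_lvl : ∀ i u v, prec i u v → lvl u = i ∧ lvl v = i
  prec_irrefl : ∀ i v, ¬ prec i v v
  prec_trans : ∀ i a b c, prec i a b → prec i b c → prec i a c

/-- A constrained level planar drawing. -/
structure CLPDrawing {V : Type} [Fintype V] (G : ConstrainedLevelGraph V) where
  x : V → ℝ
  f : V → V → ℝ → ℝ
  x_inj : ∀ u v, G.lvl u = G.lvl v → x u = x v → u = v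
  f_cont : ∀ u v, G.Edge u v → ContinuousOn (f u v) (Set.Icc (G.lvl u : ℝ) (G.lvl v : ℝ))
  f_src : ∀ u v, G.Edge u v → f u v (G.lvl u : ℝ) = x u
  f_tgt : ∀ u v, G.Edge u v → f u v (G.lvl v : ℝ) = x v
  planar : ∀ u v u' v', G.Edge u v → G.Edge u' v' → (u, v) ≠ (u', v') →
    ∀ t : ℝ, t ∈ Set.Icc (G.lvl u : ℝ) (G.lvl v : ℝ) →
      t ∈ Set.Icc (G.lvl u' : ℝ) (G.lvl v' : ℝ) → f u v t = f u' v' t →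
      ∃ w, (w = u ∨ w = v) ∧ (w = u' ∨ w = v') ∧ t = (G.lvl w : ℝ) ∧ f u v t = x w
  no_through : ∀ u v w, G.Edge u v → w ≠ u → w ≠ v →
    G.lvl u ≤ G.lvl w → G.lvl w ≤ G.lvl v → f u v (G.lvl w : ℝ) ≠ x w
  prec_ok : ∀ i u v, G.prec i u v → x u < x v

variable {V : Type} [Fintype V]

/-- Undirected reachability (being in the same connected component). -/
def Reach (G : ConstrainedLevelGraph V) : V → V → Prop :=
  Relation.ReflTransGen fun u v => G.Edge u v ∨ G.Edge v u

/-- The span of a vertex set `X` in the drawing `D`: the set of middle-level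
(level 2) vertices lying in the smallest interval (with respect to the
x-coordinates) containing all middle-level vertices of `X`. -/
def SpanSet (G : ConstrainedLevelGraph V) (D : CLPDrawing G) (X : Set V) : Set V :=
  {w | G.lvl w = 2 ∧ ∃ u ∈ X, ∃ v ∈ X, G.lvl u = 2 ∧ G.lvl v = 2 ∧
        D.x u ≤ D.x w ∧ D.x w ≤ D.x v}

/-- Adjacency in the underlying undirected graph. -/
def UAdj (G : ConstrainedLevelGraph V) (u v : V) : Prop :=
  G.Edge u v ∨ G.Edge v u

theorem UAdj.symm {G : ConstrainedLevelGraph V} {u v : V} (h : UAdj G u v) : UAdj G v u :=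
  Or.symm h

theorem Reach.symm {G : ConstrainedLevelGraph V} {u v : V} (h : Reach G u v) : Reach G v u := by
  induction h with
  | refl => exact .refl
  | tail _ e ih => exact .head e.symm ih

/-- Edges between the same two levels without a common endpoint do not swap their order. -/
theorem CLPDrawing.not_swap {G : ConstrainedLevelGraph V} (D : CLPDrawing G) {p q p' q' : V}
    (e : G.Edge p q) (e' : G.Edge p' q') (hp : G.lvl p = G.lvl p') (hq : G.lvl q = G.lvl q')
    (hpp : p ≠ p') (hqq : q ≠ q') (h₁ : D.x p ≤ D.x p') : D.x q < D.x q' := by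
  by_contra! h₂
  have hlt := G.edge_lt p q e
  have hle : (G.lvl p : ℝ) ≤ G.lvl q := by exact_mod_cast hlt.le
  have c := D.f_cont p q e
  have c' := D.f_cont p' q' e'
  have s := D.f_src p q e
  have s' := D.f_src p' q' e'
  have t := D.f_tgt p q e
  have t' := D.f_tgt p' q' e'
  rw [← hp, ← hq] at c'
  rw [← hp] at s'
  rw [← hq] at t'
  obtain ⟨r, hr, h0⟩ := intermediate_value_Icc hle (c.sub c')
    (show (0 : ℝ) ∈ _ by simp only [Pi.sub_apply, s, s', t, t', Set.mem_Icc]; constructor <;> linarith)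
  obtain ⟨w, hw, hw', -⟩ := D.planar p q p' q' e e' (by simp [hpp]) r hr
    (by rwa [← hp, ← hq]) (sub_eq_zero.mp h0)
  rcases hw with rfl | rfl <;> rcases hw' with rfl | rfl
  · exact hpp rfl
  · omega
  · omega
  · exact hqq rfl

/-- The middle-level order of vertices in distinct components is inherited by their neighbours
on a common outer level. -/
theorem CLPDrawing.neighbor_lt {G : ConstrainedLevelGraph V} (D : CLPDrawing G) {u t u' t' : V}
    (e : UAdj G u t) (e' : UAdj G u' t') (hu : G.lvl u = G.lvl u') (ht : G.lvl t = G.lvl t')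
    (hr : ¬ Reach G u u') (hx : D.x u ≤ D.x u') : D.x t < D.x t' := by
  have huu : u ≠ u' := by
    rintro rfl
    exact hr .refl
  have htt : t ≠ t' := by
    rintro rfl
    exact hr ((Relation.ReflTransGen.single e).tail e'.symm)
  rcases e with e | e <;> rcases e' with e' | e'
  · exact D.not_swap e e' hu ht huu htt hx
  · have := G.edge_lt _ _ e
    have := G.edge_lt _ _ e'
    omega
  · have := G.edge_lt _ _ e
    have := G.edge_lt _ _ e'
    omega
  · by_contra! h
    exact (D.not_swap e' e ht.symm hu.symm htt.symm huu.symm h).not_ge hx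

/-- The component of `a` contains a vertex on level `s` with neighbours weakly to the left and
weakly to the right of the middle-level vertex `w`. -/
def Straddles (G : ConstrainedLevelGraph V) (D : CLPDrawing G) (w a : V) (s : ℕ) : Prop :=
  ∃ u v t, Reach G a u ∧ Reach G a v ∧ G.lvl u = 2 ∧ G.lvl v = 2 ∧ G.lvl t = s ∧
    UAdj G u t ∧ UAdj G v t ∧ D.x u ≤ D.x w ∧ D.x w ≤ D.x v

theorem Straddles.reach {G : ConstrainedLevelGraph V} {D : CLPDrawing G} {w a b : V} {s : ℕ}
    (ha : Straddles G D w a s) (hb : Straddles G D w b s) : Reach G a b := by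
  obtain ⟨u, v, t, hu, hv, lu, lv, lt, eu, ev, xu, xv⟩ := ha
  obtain ⟨u', v', t', hu', hv', lu', lv', lt', eu', ev', xu', xv'⟩ := hb
  by_contra hab
  have h₁ : D.x t < D.x t' := D.neighbor_lt eu ev' (by omega) (by omega)
    (fun h => hab ((hu.trans h).trans hv'.symm)) (by linarith)
  have h₂ : D.x t' < D.x t := D.neighbor_lt eu' ev (by omega) (by omega)
    (fun h => hab ((hv.trans h.symm).trans hu'.symm)) (by linarith)
  exact lt_asymm h₁ h₂

theorem UAdj.lvl_eq_one_or_three {G : ConstrainedLevelGraph V}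
    (hproper : ∀ u v, G.Edge u v → G.lvl v = G.lvl u + 1) {u t : V} (e : UAdj G u t)
    (hu : G.lvl u = 2) : G.lvl t = 1 ∨ G.lvl t = 3 := by
  rcases e with e | e <;> have := hproper _ _ e <;> omega

theorem UAdj.lvl_eq_two {G : ConstrainedLevelGraph V} (hh : G.h = 3)
    (hproper : ∀ u v, G.Edge u v → G.lvl v = G.lvl u + 1) {u t : V} (e : UAdj G u t)
    (hu : G.lvl u ≠ 2) : G.lvl t = 2 := by
  have := G.lvl_one_le u
  have := G.lvl_one_le t
  have := G.lvl_le u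
  have := G.lvl_le t
  rcases e with e | e <;> have := hproper _ _ e <;> omega

/-- A component whose span contains `w` straddles `w` at the bottom or at the top. -/
theorem straddles_of_mem_spanSet {G : ConstrainedLevelGraph V} (hh : G.h = 3)
    (hproper : ∀ u v, G.Edge u v → G.lvl v = G.lvl u + 1)
    (hiso : ∀ v : V, ∃ u, G.Edge u v ∨ G.Edge v u) {D : CLPDrawing G} {w a : V}
    (hw : w ∈ SpanSet G D {v | Reach G a v}) :
    Straddles G D w a 1 ∨ Straddles G D w a 3 := by
  obtain ⟨lw, u, hu, v, hv, lu, lv, xu, xv⟩ := hw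
  have key : ∀ {p q t}, Reach G a p → Reach G a q → G.lvl p = 2 → G.lvl q = 2 →
      UAdj G p t → UAdj G q t → D.x p ≤ D.x w → D.x w ≤ D.x q →
      Straddles G D w a 1 ∨ Straddles G D w a 3 := by
    intro p q t rp rq lp lq ep eq xp xq
    rcases ep.lvl_eq_one_or_three hproper lp with h | h
    · exact .inl ⟨p, q, t, rp, rq, lp, lq, h, ep, eq, xp, xq⟩
    · exact .inr ⟨p, q, t, rp, rq, lp, lq, h, ep, eq, xp, xq⟩
  by_contra hno
  have left : ∀ {y}, Reach G a y → G.lvl y = 2 → D.x y ≤ D.x w → D.x y < D.x w := by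
    intro y ry ly xy
    refine lt_of_le_of_ne xy fun h => hno ?_
    obtain ⟨t, e⟩ := hiso y
    exact key ry ry ly ly (t := t) e.symm e.symm xy h.ge
  have inv : ∀ y, Reach G u y → (G.lvl y = 2 → D.x y < D.x w) ∧
      (G.lvl y ≠ 2 → ∃ p, Reach G a p ∧ G.lvl p = 2 ∧ UAdj G p y ∧ D.x p < D.x w) := by
    intro y hy
    induction hy with
    | refl => exact ⟨fun _ => left hu lu xu, fun h => absurd lu h⟩
    | @tail y z ry e ih =>
      have ra : Reach G a y := Relation.ReflTransGen.trans hu ry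
      by_cases ly : G.lvl y = 2
      · refine ⟨fun lz => ?_, fun _ => ⟨y, ra, ly, e, ih.1 ly⟩⟩
        have := UAdj.lvl_eq_one_or_three hproper e ly
        omega
      · refine ⟨fun lz => ?_, fun lz => absurd (UAdj.lvl_eq_two hh hproper e ly) lz⟩
        obtain ⟨p, rp, lp, ep, xp⟩ := ih.2 ly
        by_contra! h
        exact hno (key rp (ra.tail e) lp lz ep (UAdj.symm e) xp.le h)
  exact ((inv v (hu.symm.trans hv)).1 lv).not_ge xv

/-- In a constrained level planar drawing of a proper constrained
level graph of height 3 without isolated vertices, the spans of three pairwise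
distinct connected components have empty intersection. -/
theorem spans_triplewise_empty (G : ConstrainedLevelGraph V)
    (hh : G.h = 3)
    (hproper : ∀ u v, G.Edge u v → G.lvl v = G.lvl u + 1)
    (hiso : ∀ v : V, ∃ u, G.Edge u v ∨ G.Edge v u)
    (D : CLPDrawing G) (a b c : V)
    (hab : ¬ Reach G a b) (hac : ¬ Reach G a c) (hbc : ¬ Reach G b c) :
    SpanSet G D {v | Reach G a v} ∩ SpanSet G D {v | Reach G b v} ∩
      SpanSet G D {v | Reach G c v} = ∅ := by
  rw [Set.eq_empty_iff_forall_notMem]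
  rintro w ⟨⟨ha, hb⟩, hc⟩
  rcases straddles_of_mem_spanSet hh hproper hiso ha with ha | ha <;>
    rcases straddles_of_mem_spanSet hh hproper hiso hb with hb | hb <;>
    rcases straddles_of_mem_spanSet hh hproper hiso hc with hc | hc <;>
    first
    | exact hab (ha.reach hb)
    | exact hac (ha.reach hc)
    | exact hbc (hb.reach hc)
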